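/- arXiv:2001.09810 — 2 statements merged into one kernel-verified Lean document; each statement's English description precedes it below -/
import Mathlib

section
/- Let s and t be coprime positive integers of different parities with s > t, and assume s is even. If positive integers X, Y, Z satisfy the system (s² + t²)^Z + (s² − t²)^X = 2^(2Y−1) · s^(2Y) and (s² + t²)^Z − (s² − t²)^X = 2 · t^(2Y), then X = Y = Z = 1. -/
namespace GaussianInt

theorem re_odd_im_even_pow {b : GaussianInt} (hre : Odd b.re) (him : Even b.im) (n : ℕ) :
    Odd (b ^ n).re ∧ Even (b ^ n).im := by
  induction n with
  | zero => simp
  | succ n ih =>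
    obtain ⟨h1, h2⟩ := ih
    rw [pow_succ, Zsqrtd.re_mul, Zsqrtd.im_mul]
    constructor
    · exact (h1.mul hre).add_even (him.mul_left _)
    · exact (him.mul_left _).add (h2.mul_right _)

theorem im_pow_eq_im_mul {b : GaussianInt} (hre : Odd b.re) (him : Even b.im) (n : ℕ) :
    ∃ w : ℤ, (b ^ n).im = b.im * w ∧ (Odd w ↔ Odd n) := by
  induction n with
  | zero => exact ⟨0, by simp, by simp⟩
  | succ n ih =>
    obtain ⟨w, hw, hodd⟩ := ih
    have h1 := (re_odd_im_even_pow hre him n).1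
    refine ⟨(b ^ n).re + w * b.re, ?_, ?_⟩
    · rw [pow_succ, Zsqrtd.im_mul, hw]; ring
    · rw [Int.odd_add, Nat.odd_add_one, ← hodd]
      simp [h1, Int.even_mul, Int.not_even_iff_odd.mpr hre]

theorem two_pow_dvd_of_dvd_im_pow_of_odd {b : GaussianInt} (hre : Odd b.re) (him : Even b.im)
    {n K : ℕ} (hn : Odd n) (h : (2 : ℤ) ^ K ∣ (b ^ n).im) : (2 : ℤ) ^ K ∣ b.im := by
  obtain ⟨w, hw, hodd⟩ := im_pow_eq_im_mul hre him n
  rw [hw] at h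
  exact (IsCoprime.pow_left (Int.isCoprime_two_left.mpr (hodd.mpr hn))).dvd_of_dvd_mul_right h

theorem two_pow_dvd_of_dvd_im_pow_two_pow {b : GaussianInt} (hre : Odd b.re) (him : Even b.im)
    {r K : ℕ} (h : (2 : ℤ) ^ K ∣ (b ^ 2 ^ r).im) : (2 : ℤ) ^ K ∣ 2 ^ r * b.im := by
  suffices H : ∃ w : ℤ, Odd w ∧ (b ^ 2 ^ r).im = 2 ^ r * b.im * w by
    obtain ⟨w, hw, e⟩ := H
    rw [e] at h
    exact (IsCoprime.pow_left (Int.isCoprime_two_left.mpr hw)).dvd_of_dvd_mul_right h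
  clear h
  induction r with
  | zero => exact ⟨1, by simp, by simp⟩
  | succ r ih =>
    obtain ⟨w, hw, e⟩ := ih
    refine ⟨w * (b ^ 2 ^ r).re, hw.mul (re_odd_im_even_pow hre him _).1, ?_⟩
    rw [pow_succ 2 r, pow_mul, sq, Zsqrtd.im_mul, e]; ring

theorem two_pow_dvd_of_dvd_im_pow {b : GaussianInt} (hre : Odd b.re) (him : Even b.im)
    {r n K : ℕ} (hn : Odd n) (h : (2 : ℤ) ^ K ∣ (b ^ (2 ^ r * n)).im) :
    (2 : ℤ) ^ K ∣ 2 ^ r * b.im := by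
  rw [pow_mul] at h
  obtain ⟨h1, h2⟩ := re_odd_im_even_pow hre him (2 ^ r)
  exact two_pow_dvd_of_dvd_im_pow_two_pow hre him
    (two_pow_dvd_of_dvd_im_pow_of_odd h1 h2 hn h)

theorem isCoprime_star {u v : ℤ} (huv : IsCoprime v u) (hodd : Odd (v ^ 2 + u ^ 2)) :
    IsCoprime (⟨v, u⟩ : GaussianInt) ⟨v, -u⟩ := by
  obtain ⟨a, b, hab⟩ := huv
  obtain ⟨k, hk⟩ := hodd
  refine ⟨⟨v, -u⟩ - k * (a + b * ⟨0, -1⟩), - k * (a - b * ⟨0, -1⟩), ?_⟩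
  ext
  · simp
    linear_combination hk - 2 * k * hab
  · simp
    ring

/-- A sum of two coprime squares, one even, that is an `n`-th power comes from an `n`-th power
of a Gaussian integer with even imaginary part. -/
theorem exists_pow_of_sq_add_sq_eq_pow {u v c : ℤ} {n : ℕ} (hn : n ≠ 0) (hc : 0 ≤ c)
    (huv : IsCoprime v u) (hv : Odd v) (hu : Even u) (h : v ^ 2 + u ^ 2 = c ^ n) :
    ∃ b : GaussianInt, Odd b.re ∧ Even b.im ∧ b.re ^ 2 + b.im ^ 2 = c ∧
      ((b ^ n).im = u ∨ (b ^ n).im = -u) := by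
  have hodd : Odd (v ^ 2 + u ^ 2) := (hv.pow).add_even (hu.pow_of_ne_zero two_ne_zero)
  have hmul : (⟨v, u⟩ : GaussianInt) * ⟨v, -u⟩ = (c : GaussianInt) ^ n := by
    rw [← Int.cast_pow, ← h]
    ext
    · rw [Zsqrtd.re_intCast, Zsqrtd.re_mul]; ring
    · rw [Zsqrtd.im_intCast, Zsqrtd.im_mul]; ring
  obtain ⟨d, hd⟩ := exists_associated_pow_of_mul_eq_pow' (isCoprime_star huv hodd) hmul
  have norm_eq : ∀ b : GaussianInt, Associated (b ^ n) ⟨v, u⟩ → b.re ^ 2 + b.im ^ 2 = c := by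
    intro b hb
    have h1 := Zsqrtd.norm_eq_of_associated (by norm_num) hb
    have h2 : (b ^ n).norm = b.norm ^ n := map_pow Zsqrtd.normMonoidHom b n
    rw [h2] at h1
    have h3 : b.norm = b.re ^ 2 + b.im ^ 2 := by rw [Zsqrtd.norm_def]; ring
    rw [← h3]
    refine (pow_left_inj₀ (Zsqrtd.norm_nonneg (by norm_num) b) hc hn).mp ?_
    rw [h1, ← h, Zsqrtd.norm_def]; ring
  have key : ∃ b : GaussianInt, Associated (b ^ n) ⟨v, u⟩ ∧ Even b.im := by
    rcases Int.even_or_odd d.im with he | ho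
    · exact ⟨d, hd, he⟩
    · have hi : IsUnit (⟨0, 1⟩ : GaussianInt) :=
        (Zsqrtd.norm_eq_one_iff' (by norm_num) _).mp (by simp [Zsqrtd.norm_def])
      refine ⟨d * ⟨0, 1⟩, Associated.trans ?_ hd, ?_⟩
      · exact Associated.pow_pow (associated_mul_unit_left d _ hi)
      · have hcodd : Odd (d.re ^ 2 + d.im ^ 2) := by
          rw [norm_eq d hd]
          rw [h] at hodd
          exact (Int.odd_pow' hn).mp hodd
        have : Even (d.re ^ 2) := by
          rw [Int.odd_add'] at hcodd
          exact hcodd.mp ho.pow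
        simpa using (Int.even_pow.mp this).1
  obtain ⟨b, hb, him⟩ := key
  have hnorm := norm_eq b hb
  have hre : Odd b.re := by
    have hcodd : Odd (b.re ^ 2 + b.im ^ 2) := by
      rw [hnorm]
      rw [h] at hodd
      exact (Int.odd_pow' hn).mp hodd
    rw [Int.odd_add] at hcodd
    exact (Int.odd_pow' two_ne_zero).mp (hcodd.mpr (him.pow_of_ne_zero two_ne_zero))
  refine ⟨b, hre, him, hnorm, ?_⟩
  obtain ⟨w, hw⟩ := hb
  obtain ⟨h1, h2⟩ := re_odd_im_even_pow hre him n
  have hwn := (Zsqrtd.norm_eq_one_iff' (by norm_num) (w : GaussianInt)).mpr w.isUnit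
  rw [Zsqrtd.norm_def] at hwn
  have e := congrArg Zsqrtd.im hw
  rw [Zsqrtd.im_mul] at e
  simp only at e
  have hwe : Even (w : GaussianInt).im := by
    rw [← e, Int.even_add] at hu
    have := hu.mpr (h2.mul_right _)
    exact (Int.even_mul.mp this).resolve_left (Int.not_even_iff_odd.mpr h1)
  have hw0 : (w : GaussianInt).im = 0 := by
    obtain ⟨k, hk⟩ := hwe
    rw [hk] at hwn ⊢
    have : k = 0 := by
      by_contra hk0
      have : 0 < k ^ 2 := by positivity
      nlinarith [mul_self_nonneg (w : GaussianInt).re]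
    simp [this]
  rw [hw0] at hwn e
  have hw1 : (w : GaussianInt).re * (w : GaussianInt).re = 1 := by linarith
  rcases mul_self_eq_one_iff.mp hw1 with h' | h' <;> rw [h'] at e
  · left; linarith
  · right; linarith

end GaussianInt

/-- If the `2 ^ r * n`-th power of `c`, with `n` odd, is a sum of two coprime squares, then a high
power of two dividing the even square root forces `c` or `r` to be large. -/
theorem two_pow_le_of_sq_add_sq_eq_pow {u v c : ℕ} {r n K : ℕ} (hn : Odd n) (hu0 : 0 < u)
    (huv : Nat.Coprime v u) (hv : Odd v) (hu : Even u) (hK : 2 ^ K ∣ u)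
    (h : v ^ 2 + u ^ 2 = c ^ (2 ^ r * n)) : ∃ m : ℕ, m ^ 2 ≤ c ∧ 2 ^ K ≤ 2 ^ r * m := by
  have hN : 2 ^ r * n ≠ 0 := mul_ne_zero (by positivity) hn.pos.ne'
  obtain ⟨b, hre, him, hnorm, hb⟩ := GaussianInt.exists_pow_of_sq_add_sq_eq_pow (u := u) (v := v)
    (c := c) hN (by positivity) (Nat.isCoprime_iff_coprime.mpr huv) (by exact_mod_cast hv)
    (by exact_mod_cast hu) (by exact_mod_cast h)
  have hKz : (2 : ℤ) ^ K ∣ u := by exact_mod_cast hK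
  have hd : (2 : ℤ) ^ K ∣ (b ^ (2 ^ r * n)).im := by
    rcases hb with hb | hb <;> rw [hb]
    · exact hKz
    · exact hKz.neg_right
  have hdvd := GaussianInt.two_pow_dvd_of_dvd_im_pow hre him hn hd
  have hne : b.im ≠ 0 := by
    intro h0
    obtain ⟨w, hw, -⟩ := GaussianInt.im_pow_eq_im_mul hre him (2 ^ r * n)
    rw [h0, zero_mul] at hw
    omega
  refine ⟨b.im.natAbs, ?_, ?_⟩
  · zify
    rw [sq_abs]
    nlinarith [sq_nonneg b.re]
  · have := Int.natAbs_dvd_natAbs.mpr hdvd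
    rw [Int.natAbs_mul, Int.natAbs_pow, Int.natAbs_pow] at this
    exact Nat.le_of_dvd (Nat.mul_pos (by positivity) (Int.natAbs_pos.mpr hne)) this

theorem exponent_eq_one_of_sq_add_sq_pow {s t Y Z : ℕ} (hst : Nat.Coprime s t)
    (hgt : t < s) (ht : Odd t) (hs : 2 ∣ s) (hY : 0 < Y) (hZ : 0 < Z)
    (h : (t ^ Y) ^ 2 + (2 ^ (Y - 1) * s ^ Y) ^ 2 = (s ^ 2 + t ^ 2) ^ Z)
    (hlt : t ^ Y < 2 ^ (Y - 1) * s ^ Y) : Y = 1 := by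
  by_contra hY1
  obtain ⟨y, rfl⟩ : ∃ y, Y = y + 2 := ⟨Y - 2, by omega⟩
  simp only [show y + 2 - 1 = y + 1 by omega] at h hlt
  have hs2 : 2 ≤ s := Nat.le_of_dvd (by omega) hs
  have ht0 : 0 < t := ht.pos
  set u := 2 ^ (y + 1) * s ^ (y + 2) with hu
  have hu0 : 0 < u := by positivity
  have husq : u ^ 2 = 2 ^ (2 * y + 2) * s ^ (2 * y + 4) := by rw [hu]; ring
  have hc2 : s ^ 2 + t ^ 2 < 2 * s ^ 2 := by nlinarith
  have hYZ : y + 2 < Z := by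
    by_contra hle
    obtain ⟨k, hk⟩ : ∃ k, y + 2 = Z + k := ⟨y + 2 - Z, by omega⟩
    have h1 : u ^ 2 < (2 * s ^ 2) ^ Z := by
      calc u ^ 2 < (t ^ (y + 2)) ^ 2 + u ^ 2 := by
            have : 0 < (t ^ (y + 2)) ^ 2 := by positivity
            omega
        _ = (s ^ 2 + t ^ 2) ^ Z := h
        _ ≤ _ := Nat.pow_le_pow_left hc2.le _
    have h2 : (2 * s ^ 2) ^ Z ≤ u ^ 2 := by
      rw [husq, mul_pow, ← pow_mul]
      exact Nat.mul_le_mul (Nat.pow_le_pow_right (by norm_num) (by omega))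
        (Nat.pow_le_pow_right (by omega) (by omega))
    omega
  obtain ⟨k, rfl⟩ : ∃ k, Z = y + 2 + (k + 1) := ⟨Z - (y + 3), by omega⟩
  have hsk : s ^ (2 * k + 2) < 2 ^ (2 * y + 3) := by
    have h1 : (s ^ 2) ^ (y + 2 + (k + 1)) < 2 * u ^ 2 := by
      calc (s ^ 2) ^ (y + 2 + (k + 1)) ≤ (s ^ 2 + t ^ 2) ^ (y + 2 + (k + 1)) :=
            Nat.pow_le_pow_left (by omega) _
        _ = (t ^ (y + 2)) ^ 2 + u ^ 2 := h.symm
        _ < 2 * u ^ 2 := by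
          have := Nat.pow_lt_pow_left hlt two_ne_zero
          omega
    rw [husq] at h1
    have h2 : s ^ (2 * y + 4) * s ^ (2 * k + 2) < s ^ (2 * y + 4) * 2 ^ (2 * y + 3) := by
      calc _ = (s ^ 2) ^ (y + 2 + (k + 1)) := by ring
        _ < _ := h1
        _ = _ := by ring
    exact lt_of_mul_lt_mul_left h2 (by positivity)
  have hky : k < y + 1 := by
    have h1 : 2 ^ (2 * k + 2) < 2 ^ (2 * y + 3) := (Nat.pow_le_pow_left hs2 _).trans_lt hsk
    have := (Nat.pow_lt_pow_iff_right (by norm_num)).mp h1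
    omega
  have hssq : s ^ 2 < 2 ^ (2 * y + 3) :=
    (Nat.pow_le_pow_right (by omega) (by omega)).trans_lt hsk
  obtain ⟨r, n, hn, hrn⟩ := Nat.exists_eq_two_pow_mul_odd (n := y + 2 + (k + 1)) (by omega)
  have hcop : Nat.Coprime (t ^ (y + 2)) u :=
    Nat.Coprime.mul_right (Nat.Coprime.pow _ _ (Nat.coprime_two_right.mpr ht))
      (Nat.Coprime.pow _ _ hst.symm)
  have hK : 2 ^ (2 * y + 3) ∣ u := by
    rw [show 2 * y + 3 = (y + 1) + (y + 2) by ring, pow_add]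
    exact Nat.mul_dvd_mul_left _ (pow_dvd_pow_of_dvd hs _)
  have hue : Even u := even_iff_two_dvd.mpr ((dvd_pow_self 2 (by omega)).trans hK)
  obtain ⟨m, hm, hle⟩ := two_pow_le_of_sq_add_sq_eq_pow hn hu0 hcop ht.pow hue hK (hrn ▸ h)
  have hm2 : m < 2 ^ (y + 2) := by
    refine lt_of_pow_lt_pow_left₀ 2 (by positivity) ?_
    calc m ^ 2 < 2 * 2 ^ (2 * y + 3) := by omega
      _ = _ := by ring
  have hr : y + 2 ≤ r := by
    have h1 : 2 ^ (2 * y + 3) < 2 ^ (r + (y + 2)) := by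
      rw [pow_add 2 r]
      exact hle.trans_lt (Nat.mul_lt_mul_of_pos_left hm2 (by positivity))
    have := (Nat.pow_lt_pow_iff_right (by norm_num)).mp h1
    omega
  have h1 : 2 ^ (y + 2) ≤ y + 2 + (k + 1) := by
    rw [hrn]
    exact (Nat.pow_le_pow_right (by norm_num) hr).trans (Nat.le_mul_of_pos_right _ hn.pos)
  have h2 : y + 1 < 2 ^ (y + 1) := Nat.lt_two_pow_self
  have h3 : 2 ^ (y + 2) = 2 * 2 ^ (y + 1) := by ring
  omega

theorem system_trivial_solution_s_even
    (s t : ℕ) (hs : 0 < s) (ht : 0 < t) (hst : Nat.Coprime s t)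
    (hgt : s > t) (hpar : s % 2 ≠ t % 2) (hseven : 2 ∣ s)
    (X Y Z : ℕ) (hX : 0 < X) (hY : 0 < Y) (hZ : 0 < Z)
    (h1 : (s ^ 2 + t ^ 2) ^ Z + (s ^ 2 - t ^ 2) ^ X = 2 ^ (2 * Y - 1) * s ^ (2 * Y))
    (h2 : (s ^ 2 + t ^ 2) ^ Z - (s ^ 2 - t ^ 2) ^ X = 2 * t ^ (2 * Y)) :
    X = 1 ∧ Y = 1 ∧ Z = 1 := by
  have hodd : Odd t := by rw [Nat.odd_iff]; omega
  have hsq : t ^ 2 + 2 ≤ s ^ 2 := by nlinarith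
  have ht2 : 0 < t ^ 2 := by positivity
  have htY : 0 < t ^ (2 * Y) := by positivity
  have ha : 0 < (s ^ 2 - t ^ 2) ^ X := Nat.pow_pos (by omega)
  have e1 : 2 ^ (2 * Y - 1) * s ^ (2 * Y) = 2 * (2 ^ (Y - 1) * s ^ Y) ^ 2 := by
    obtain ⟨y, rfl⟩ : ∃ y, Y = y + 1 := ⟨Y - 1, by omega⟩
    simp only [show 2 * (y + 1) - 1 = 2 * y + 1 by omega, Nat.add_sub_cancel]
    ring
  have e2 : t ^ (2 * Y) = (t ^ Y) ^ 2 := by ring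
  rw [e1] at h1
  rw [e2] at h2 htY
  have hc : (t ^ Y) ^ 2 + (2 ^ (Y - 1) * s ^ Y) ^ 2 = (s ^ 2 + t ^ 2) ^ Z := by omega
  have hlt : t ^ Y < 2 ^ (Y - 1) * s ^ Y := lt_of_pow_lt_pow_left₀ 2 (by positivity) (by omega)
  obtain rfl := exponent_eq_one_of_sq_add_sq_pow hst hgt hodd hseven hY hZ hc hlt
  simp only [pow_one, Nat.sub_self, pow_zero, one_mul] at h1 h2 hc
  refine ⟨?_, rfl, ?_⟩
  · exact Nat.pow_right_injective (show 2 ≤ s ^ 2 - t ^ 2 by omega)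
      (show (s ^ 2 - t ^ 2) ^ X = (s ^ 2 - t ^ 2) ^ 1 by rw [pow_one]; omega)
  · exact Nat.pow_right_injective (show 2 ≤ s ^ 2 + t ^ 2 by omega)
      (show (s ^ 2 + t ^ 2) ^ Z = (s ^ 2 + t ^ 2) ^ 1 by rw [pow_one]; omega)
end

section
/- Let s and t be coprime positive integers of different parities with s > t, and suppose 15 divides s·t. Then the primitive Pythagorean triple a = s² − t², b = 2st, c = s² + t² satisfies 60 ∣ b, and both a·c and 15 are coprime (i.e., gcd(ac, 15) = 1). -/
/-- A prime dividing the product of two coprime numbers divides neither the sum nor the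
difference of their squares. -/
theorem Nat.Coprime.sq_sub_sq_mul_sq_add_sq_coprime {s t p : ℕ} (hst : Nat.Coprime s t)
    (hle : t ≤ s) (hp : p.Prime) (hdvd : p ∣ s * t) :
    Nat.Coprime ((s ^ 2 - t ^ 2) * (s ^ 2 + t ^ 2)) p := by
  rw [Nat.coprime_comm, hp.coprime_iff_not_dvd]
  intro h
  have not_both : ¬ (p ∣ s ∧ p ∣ t) := fun ⟨h₁, h₂⟩ =>
    Nat.not_coprime_of_dvd_of_dvd hp.one_lt h₁ h₂ hst
  have hsq : t ^ 2 ≤ s ^ 2 := Nat.pow_le_pow_left hle 2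
  rcases hp.dvd_mul.1 hdvd with hs | ht
  · have hs2 : p ∣ s ^ 2 := dvd_pow hs two_ne_zero
    refine not_both ⟨hs, hp.dvd_of_dvd_pow (n := 2) ?_⟩
    rcases hp.dvd_mul.1 h with h | h
    · exact (Nat.dvd_sub_iff_right hsq hs2).1 h
    · exact (Nat.dvd_add_right hs2).1 h
  · have ht2 : p ∣ t ^ 2 := dvd_pow ht two_ne_zero
    refine not_both ⟨hp.dvd_of_dvd_pow (n := 2) ?_, ht⟩
    rcases hp.dvd_mul.1 h with h | h
    · exact (Nat.dvd_sub_iff_left hsq ht2).1 h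
    · exact (Nat.dvd_add_left ht2).1 h

theorem triple_class_k6
    (s t : ℕ) (hs : 0 < s) (ht : 0 < t) (hst : Nat.Coprime s t)
    (hgt : s > t) (hpar : s % 2 ≠ t % 2) (h15 : 15 ∣ s * t) :
    60 ∣ 2 * s * t ∧ Nat.Coprime ((s ^ 2 - t ^ 2) * (s ^ 2 + t ^ 2)) 15 := by
  constructor
  · have h2 : 2 ∣ s * t := by
      rcases Nat.mod_two_eq_zero_or_one s with h | h
      · exact (Nat.dvd_of_mod_eq_zero h).mul_right t
      · exact Dvd.dvd.mul_left (by omega) s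
    rw [mul_assoc]
    omega
  · exact Nat.Coprime.mul_right (m := 3) (n := 5)
      (hst.sq_sub_sq_mul_sq_add_sq_coprime hgt.le Nat.prime_three
        ((by norm_num : 3 ∣ 15).trans h15))
      (hst.sq_sub_sq_mul_sq_add_sq_coprime hgt.le Nat.prime_five
        ((by norm_num : 5 ∣ 15).trans h15))
end
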